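/- arXiv:2006.10648 — 8 statements merged into one kernel-verified Lean document; each statement's English description precedes it below -/
import Mathlib

section
/- Fix ħ ∈ ℂ*. Let a, b, q, p, r : ℝ → ℂ be differentiable functions with p(t) ≠ 0 for all t, satisfying the ODE system a' = 0, b' = 1, q' = 0, p' = 1/(2p), r' = −1/ħ + r/(2p²) (the first isomonodromy flow). Then: (i) the quantity p² − q³ − a q − b is constant along the flow; and (ii) for every fixed x ∈ ℂ with x ≠ q(t), the potential Q(x,ħ) = ħ⁻²(x³ + a x + b) + ħ⁻¹(p/(x−q) + r) + 3/(4(x−q)²) + r/(2p(x−q)) + r²/(4p²) is constant in t, i.e., its t-derivative vanishes identically. -/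
/-- Along the first isomonodromy flow
`a' = 0, b' = 1, q' = 0, p' = 1/(2p), r' = -1/ħ + r/(2p²)`,
the quantity `p² - q³ - aq - b` is constant, and for every fixed `x` with `x ≠ q(t)`
the potential `Q(x,ħ)` of the deformed cubic oscillator is constant in `t`. -/
theorem first_isomonodromy_flow_preserves_potential (hbar : ℂ) (hhbar : hbar ≠ 0)
    (a b q p r : ℝ → ℂ)
    (ha : Differentiable ℝ a) (hb : Differentiable ℝ b) (hq : Differentiable ℝ q)
    (hp : Differentiable ℝ p) (hr : Differentiable ℝ r)
    (hpne : ∀ t, p t ≠ 0)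
    (ha' : ∀ t, deriv a t = 0)
    (hb' : ∀ t, deriv b t = 1)
    (hq' : ∀ t, deriv q t = 0)
    (hp' : ∀ t, deriv p t = 1 / (2 * p t))
    (hr' : ∀ t, deriv r t = -1 / hbar + r t / (2 * p t ^ 2)) :
    (∀ s t : ℝ, p s ^ 2 - q s ^ 3 - a s * q s - b s
        = p t ^ 2 - q t ^ 3 - a t * q t - b t) ∧
    (∀ x : ℂ, (∀ t : ℝ, x ≠ q t) → ∀ t : ℝ,
      deriv (fun t : ℝ =>
        (x ^ 3 + a t * x + b t) / hbar ^ 2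
          + (p t / (x - q t) + r t) / hbar
          + 3 / (4 * (x - q t) ^ 2)
          + r t / (2 * p t * (x - q t))
          + r t ^ 2 / (4 * p t ^ 2)) t = 0) := by
  have Ha : ∀ t, HasDerivAt a 0 t := fun t => ha' t ▸ (ha t).hasDerivAt
  have Hb : ∀ t, HasDerivAt b 1 t := fun t => hb' t ▸ (hb t).hasDerivAt
  have Hq : ∀ t, HasDerivAt q 0 t := fun t => hq' t ▸ (hq t).hasDerivAt
  have Hp : ∀ t, HasDerivAt p (1 / (2 * p t)) t := fun t => hp' t ▸ (hp t).hasDerivAt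
  have Hr : ∀ t, HasDerivAt r (-1 / hbar + r t / (2 * p t ^ 2)) t :=
    fun t => hr' t ▸ (hr t).hasDerivAt
  constructor
  · have key : ∀ t, HasDerivAt (fun t => p t ^ 2 - q t ^ 3 - a t * q t - b t) 0 t := by
      intro t
      have hpt := hpne t
      have h := ((((Hp t).fun_pow 2).fun_sub ((Hq t).fun_pow 3)).fun_sub
        ((Ha t).fun_mul (Hq t))).fun_sub (Hb t)
      refine h.congr_deriv ?_
      field_simp
      norm_num
    intro s t
    exact is_const_of_deriv_eq_zero (fun t => (key t).differentiableAt)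
      (fun t => (key t).deriv) s t
  · intro x hx t
    have hpt := hpne t
    have hxq : x - q t ≠ 0 := sub_ne_zero.mpr (hx t)
    have Hxq : HasDerivAt (fun t => x - q t) 0 t := by
      simpa using (Hq t).const_sub x
    have h1 := ((((Ha t).mul_const x).const_add (x ^ 3)).fun_add (Hb t)).div_const (hbar ^ 2)
    have h2 := (((Hp t).fun_div Hxq hxq).fun_add (Hr t)).div_const hbar
    have h3 := (hasDerivAt_const t (3 : ℂ)).fun_div ((Hxq.fun_pow 2).const_mul (4 : ℂ))
      (mul_ne_zero (by norm_num) (pow_ne_zero 2 hxq))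
    have h4 := (Hr t).fun_div (((Hp t).const_mul 2).fun_mul Hxq)
      (mul_ne_zero (mul_ne_zero two_ne_zero hpt) hxq)
    have h5 := ((Hr t).fun_pow 2).fun_div (((Hp t).fun_pow 2).const_mul (4 : ℂ))
      (mul_ne_zero (by norm_num) (pow_ne_zero 2 hpt))
    have h := (((h1.fun_add h2).fun_add h3).fun_add h4).fun_add h5
    rw [h.deriv]
    generalize x - q t = y at hxq ⊢
    field_simp
    norm_num
    try ring
end

section
/- Fix ħ ∈ ℂ* and complex numbers a, b, q, p, r with p ≠ 0 and p² = q³ + aq + b. Define the potential Q(x) = ħ⁻²(x³ + a x + b) + ħ⁻¹(p/(x−q) + r) + 3/(4(x−q)²) + r/(2p(x−q)) + r²/(4p²), let A(x) = 1/(x−q), and let Q̇(x) denote the derivative of Q(x) in the parameters along the second isomonodromy flow, i.e. Q̇(x) is obtained by differentiating Q(x) with respect to (a,b,q,p,r) in the direction ȧ = 1, ḃ = −q, q̇ = −2p/ħ − r/p, ṗ = −(3q²+a)/ħ − r(3q²+a)/(2p²), ṙ = −r²(3q²+a)/(2p³). Then for all x ≠ q: A'''(x) − 4·Q(x)·A'(x)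 − 2·Q'(x)·A(x) + 2·Q̇(x) = 0, where primes denote x-derivatives. -/
/-- The potential of the deformed cubic oscillator,
`Q(x) = ħ⁻²(x³+ax+b) + ħ⁻¹(p/(x-q)+r) + 3/(4(x-q)²) + r/(2p(x-q)) + r²/(4p²)`. -/
noncomputable def Qpot (a b q p r hbar x : ℂ) : ℂ :=
  (x ^ 3 + a * x + b) / hbar ^ 2 + (p / (x - q) + r) / hbar
    + 3 / (4 * (x - q) ^ 2) + r / (2 * p * (x - q)) + r ^ 2 / (4 * p ^ 2)

theorem hasDerivAt_Qpot_param (a b q p r hbar x a1 b1 q1 p1 r1 : ℂ) (hp : p ≠ 0)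
    (hx : x - q ≠ 0) :
    HasDerivAt (fun t : ℂ => Qpot (a + t * a1) (b + t * b1) (q + t * q1) (p + t * p1)
      (r + t * r1) hbar x)
      ((a1 * x + b1) / hbar ^ 2 + (p1 / (x - q) + p * q1 / (x - q) ^ 2 + r1) / hbar
        + 3 * q1 / (2 * (x - q) ^ 3)
        + (r1 / (2 * p * (x - q)) - r * p1 / (2 * p ^ 2 * (x - q))
          + r * q1 / (2 * p * (x - q) ^ 2))
        + (r * r1 / (2 * p ^ 2) - r ^ 2 * p1 / (2 * p ^ 3))) 0 := by
  have lin : ∀ c d : ℂ, HasDerivAt (fun t : ℂ => c + t * d) d 0 := fun c d => by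
    simpa using ((hasDerivAt_id (0 : ℂ)).mul_const d).const_add c
  have hu : HasDerivAt (fun t : ℂ => x - (q + t * q1)) (-q1) 0 := (lin q q1).const_sub x
  have hP := lin p p1
  have hR := lin r r1
  have h1 := ((((lin a a1).mul_const x).const_add (x ^ 3)).add (lin b b1)).div_const (hbar ^ 2)
  have h2 := ((hP.div hu (by simpa using hx)).add hR).div_const hbar
  have h3 := (hasDerivAt_const (0 : ℂ) (3 : ℂ)).div ((hu.pow 2).const_mul 4)
    (by simpa using hx)
  have h4 := hR.div ((hP.const_mul 2).mul hu) (by simpa using ⟨hp, hx⟩)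
  have h5 := (hR.pow 2).div ((hP.pow 2).const_mul 4) (by simpa using hp)
  have h := (((h1.add h2).add h3).add h4).add h5
  refine HasDerivAt.congr_deriv h ?_
  simp only [zero_mul, add_zero, Pi.pow_apply, Pi.mul_apply]
  congr 1
  · congr 1
    · congr 1
      · congr 1
        congr 1
        field_simp
        ring
      · field_simp
        ring
    · field_simp
      ring
  · field_simp
    ring

theorem hasDerivAt_Qpot_x (a b q p r hbar x : ℂ) (hp : p ≠ 0) (hx : x - q ≠ 0) :
    HasDerivAt (Qpot a b q p r hbar)
      ((3 * x ^ 2 + a) / hbar ^ 2 + (-p / (x - q) ^ 2) / hbar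
        - 3 / (2 * (x - q) ^ 3) - r / (2 * p * (x - q) ^ 2)) x := by
  have hu : HasDerivAt (fun y : ℂ => y - q) 1 x := (hasDerivAt_id x).sub_const q
  have h1 := ((((hasDerivAt_id x).pow 3).add ((hasDerivAt_id x).const_mul a)).add_const b).div_const
    (hbar ^ 2)
  have h2 := (((hasDerivAt_const x p).div hu hx).add_const r).div_const hbar
  have h3 := (hasDerivAt_const x (3 : ℂ)).div ((hu.pow 2).const_mul 4) (by simpa using hx)
  have h4 := (hasDerivAt_const x r).div (hu.const_mul (2 * p)) (by simpa using ⟨hp, hx⟩)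
  have h := (((h1.add h2).add h3).add h4).add_const (r ^ 2 / (4 * p ^ 2))
  refine HasDerivAt.congr_deriv h ?_
  simp only [Pi.pow_apply, id, sub_eq_add_neg (_ + _ : ℂ)]
  congr 1
  · congr 1
    · congr 1
      · congr 1
        norm_num
      · congr 1
        field_simp
        ring
    · field_simp
      ring
  · field_simp
    ring

theorem deriv_A1 (q : ℂ) : deriv (fun y : ℂ => 1 / (y - q)) = fun y => -1 * (y - q) ^ (-2 : ℤ) := by
  funext y
  have := deriv_comp_sub_const (f := fun z : ℂ => z ^ (-1 : ℤ)) q y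
  simp only [deriv_zpow] at this
  norm_num at this ⊢
  exact this

theorem deriv_zpow_sub (q c : ℂ) (m : ℤ) :
    deriv (fun y : ℂ => c * (y - q) ^ m) = fun y => (c * m) * (y - q) ^ (m - 1) := by
  funext y
  have := deriv_comp_sub_const (f := fun z : ℂ => z ^ m) q y
  simp only [deriv_zpow] at this
  rw [deriv_const_mul_field, this, mul_assoc]

/-- with `A(x) = 1/(x-q)` and `Q̇` the derivative of the potential in the
parameters along the second isomonodromy flow, one has
`A''' - 4 Q A' - 2 Q' A + 2 Q̇ = 0` for all `x ≠ q`. -/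
theorem second_flow_flatness (hbar a b q p r : ℂ) (hhbar : hbar ≠ 0) (hp : p ≠ 0)
    (hell : p ^ 2 = q ^ 3 + a * q + b) (x : ℂ) (hx : x ≠ q) :
    deriv (deriv (deriv (fun y : ℂ => 1 / (y - q)))) x
      - 4 * Qpot a b q p r hbar x * deriv (fun y : ℂ => 1 / (y - q)) x
      - 2 * deriv (Qpot a b q p r hbar) x * (1 / (x - q))
      + 2 * deriv (fun t : ℂ =>
          Qpot (a + t * 1) (b + t * (-q))
            (q + t * (-2 * p / hbar - r / p))
            (p + t * (-(3 * q ^ 2 + a) / hbar - r * (3 * q ^ 2 + a) / (2 * p ^ 2)))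
            (r + t * (-(r ^ 2 * (3 * q ^ 2 + a)) / (2 * p ^ 3)))
            hbar x) 0 = 0 := by
  have hu : x - q ≠ 0 := sub_ne_zero.mpr hx
  rw [(hasDerivAt_Qpot_param _ _ _ _ _ _ _ _ _ _ _ _ hp hu).deriv,
    (hasDerivAt_Qpot_x _ _ _ _ _ _ _ hp hu).deriv, deriv_A1, deriv_zpow_sub, deriv_zpow_sub]
  have e2 : (x - q) ^ (-2 : ℤ) = 1 / (x - q) ^ 2 := by
    rw [zpow_neg, one_div]; norm_cast
  have e4 : (x - q) ^ (-2 - 1 - 1 : ℤ) = 1 / (x - q) ^ 4 := by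
    norm_num
  simp only [e2, e4]
  unfold Qpot
  have hb : b = p ^ 2 - q ^ 3 - a * q := by rw [hell]; ring
  subst hb
  obtain ⟨u, rfl⟩ : ∃ u, x = q + u := ⟨x - q, by ring⟩
  simp only [add_sub_cancel_left] at hu ⊢
  push_cast
  field_simp
  ring
end

section
/- Let a, b, q, p, r : ℝ → ℂ be differentiable functions with p(t) ≠ 0 for all t, satisfying the second isomonodromy flow equations ȧ = 1, ḃ = −q, q̇ = −2p/ħ − r/p, ṗ = −(3q²+a)/ħ − r(3q²+a)/(2p²), ṙ = −r²(3q²+a)/(2p³), for a fixed ħ ∈ ℂ*. Then the quantity p² − q³ − a q − b is constant along the flow; in particular the constraint locus p² = q³ + aq + b is invariant under the flow. -/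
/-- the quantity `p² - q³ - aq - b` is constant along the second isomonodromy
flow; in particular the constraint locus `p² = q³ + aq + b` is invariant under the flow. -/
theorem second_flow_preserves_elliptic_curve (hbar : ℂ) (hhbar : hbar ≠ 0)
    (a b q p r : ℝ → ℂ)
    (ha : Differentiable ℝ a) (hb : Differentiable ℝ b) (hq : Differentiable ℝ q)
    (hp : Differentiable ℝ p) (hr : Differentiable ℝ r)
    (hpne : ∀ t, p t ≠ 0)
    (ha' : ∀ t, deriv a t = 1)
    (hb' : ∀ t, deriv b t = -q t)
    (hq' : ∀ t, deriv q t = -2 * p t / hbar - r t / p t)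
    (hp' : ∀ t, deriv p t = -(3 * q t ^ 2 + a t) / hbar
        - r t * (3 * q t ^ 2 + a t) / (2 * p t ^ 2))
    (hr' : ∀ t, deriv r t = -(r t ^ 2) * (3 * q t ^ 2 + a t) / (2 * p t ^ 3)) :
    (∀ s t : ℝ, p s ^ 2 - q s ^ 3 - a s * q s - b s
        = p t ^ 2 - q t ^ 3 - a t * q t - b t) ∧
    (∀ t₀ : ℝ, p t₀ ^ 2 = q t₀ ^ 3 + a t₀ * q t₀ + b t₀ →
      ∀ t : ℝ, p t ^ 2 = q t ^ 3 + a t * q t + b t) := by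
  have key : ∀ s t : ℝ, p s ^ 2 - q s ^ 3 - a s * q s - b s
        = p t ^ 2 - q t ^ 3 - a t * q t - b t := by
    have hd : ∀ t, HasDerivAt (fun t => p t ^ 2 - q t ^ 3 - a t * q t - b t) 0 t := by
      intro t
      have h1 := (hp t).hasDerivAt
      have h2 := (hq t).hasDerivAt
      have h3 := (ha t).hasDerivAt
      have h4 := (hb t).hasDerivAt
      have h := (((h1.fun_pow 2).fun_sub (h2.fun_pow 3)).fun_sub (h3.fun_mul h2)).fun_sub h4
      refine h.congr_deriv ?_
      rw [ha', hb', hq', hp']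
      have hpt := hpne t
      push_cast
      field_simp
      ring
    exact is_const_of_deriv_eq_zero (fun t => (hd t).differentiableAt) (fun t => (hd t).deriv)
  refine ⟨key, fun t₀ h0 t => ?_⟩
  have h := key t t₀
  linear_combination h + h0
end

section
/- Define partial maps on ℂ* × ℂ* by C₁(x,y) = (x, y(1+x)), C₂(x,y) = (x(1+y)⁻¹, y), and C₁₂(x,y) = (x(1+xy)⁻¹, y(1+xy)). Then for all x, y ∈ ℂ* such that all expressions below are defined and lie in ℂ* × ℂ* (i.e. 1+x ≠ 0, 1+y ≠ 0, 1+y+xy ≠ 0, 1+y(1+x) ≠ 0), one has C₂(C₁(x,y)) = C₁(C₁₂(C₂(x,y))). Equivalently, as birational automorphisms of the torus (ℂ*)², C_{γ₁} ∘ C_{γ₂} = C_{γ₂} ∘ C_{γ₁+γ₂} ∘ C_{γ₁} (the pentagon wall-crossing identity for the A₂ quiver). -/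
/-- The cluster transformation `C_{γ₁}` in the coordinates `(x,y)`. -/
noncomputable def C₁ : ℂ × ℂ → ℂ × ℂ := fun z => (z.1, z.2 * (1 + z.1))

/-- The cluster transformation `C_{γ₂}` in the coordinates `(x,y)`. -/
noncomputable def C₂ : ℂ × ℂ → ℂ × ℂ := fun z => (z.1 * (1 + z.2)⁻¹, z.2)

/-- The cluster transformation `C_{γ₁+γ₂}` in the coordinates `(x,y)`. -/
noncomputable def C₁₂ : ℂ × ℂ → ℂ × ℂ :=
  fun z => (z.1 * (1 + z.1 * z.2)⁻¹, z.2 * (1 + z.1 * z.2))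

/-- the pentagon wall-crossing identity
`C_{γ₁} ∘ C_{γ₂} = C_{γ₂} ∘ C_{γ₁+γ₂} ∘ C_{γ₁}` for the A₂ quiver
(note the order of composition: `C₂(C₁(x,y)) = C₁(C₁₂(C₂(x,y)))`). -/
theorem pentagon_wall_crossing (x y : ℂ) (hx : x ≠ 0) (hy : y ≠ 0)
    (h1x : 1 + x ≠ 0) (h1y : 1 + y ≠ 0)
    (h1yxy : 1 + y + x * y ≠ 0) (h1y1x : 1 + y * (1 + x) ≠ 0) :
    C₂ (C₁ (x, y)) = C₁ (C₁₂ (C₂ (x, y))) := by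
  have e : 1 + x * (1 + y)⁻¹ * y = (1 + y + x * y) * (1 + y)⁻¹ := by
    field_simp
  have e2 : x * (1 + y)⁻¹ * ((1 + y + x * y) * (1 + y)⁻¹)⁻¹ = x * (1 + y + x * y)⁻¹ := by
    field_simp
  have e3 : 1 + y * (1 + x) = 1 + y + x * y := by ring
  simp only [C₁, C₂, C₁₂, e, e2, e3, Prod.mk.injEq, true_and]
  have e4 : 1 + x * (1 + y + x * y)⁻¹ = ((1 + y) * (1 + x)) * (1 + y + x * y)⁻¹ := by
    rw [eq_mul_inv_iff_mul_eq₀ h1yxy, add_mul, mul_assoc, inv_mul_cancel₀ h1yxy]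
    ring
  rw [e4]
  calc y * (1 + x) = y * (1 + x) * ((1 + y) * (1 + y)⁻¹)
        * ((1 + y + x * y) * (1 + y + x * y)⁻¹) := by
        rw [mul_inv_cancel₀ h1y, mul_inv_cancel₀ h1yxy]; ring
    _ = _ := by ring
end

section
/- Let a, b, α, β, γ ∈ ℂ, let q₀ ∈ ℂ, and let p be a complex-differentiable function of q on a neighbourhood of q₀ with p(q)² = q³ + a q + b there and p(q₀) ≠ 0. Then 2·p(q₀)·(d/dq)[(αq² + βq + γ)/p(q)] evaluated at q₀ equals α q₀ − β + (1/p(q₀)²)·((2aα − 3γ)q₀² + (2aβ + 3bα)q₀ + (3bβ − aγ)). -/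
/-- for a local branch `p(q)` of the square root of `q³ + aq + b`
with `p(q₀) ≠ 0`, one has
`2p·d/dq[(αq²+βq+γ)/p] = αq - β + ((2aα-3γ)q² + (2aβ+3bα)q + (3bβ-aγ))/p²` at `q₀`. -/
theorem derivative_identity_on_curve (a b α β γ q₀ : ℂ) (p : ℂ → ℂ)
    (hd : ∀ᶠ x in nhds q₀, DifferentiableAt ℂ p x)
    (hsq : ∀ᶠ x in nhds q₀, p x ^ 2 = x ^ 3 + a * x + b)
    (hp0 : p q₀ ≠ 0) :
    2 * p q₀ * deriv (fun q : ℂ => (α * q ^ 2 + β * q + γ) / p q) q₀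
      = α * q₀ - β + (1 / p q₀ ^ 2) *
          ((2 * a * α - 3 * γ) * q₀ ^ 2 + (2 * a * β + 3 * b * α) * q₀
            + (3 * b * β - a * γ)) := by
  have hp := hd.self_of_nhds.hasDerivAt
  have h0 := hsq.self_of_nhds
  have hid := hasDerivAt_id' q₀
  have h1 : HasDerivAt (fun x => p x ^ 2) (2 * p q₀ * deriv p q₀) q₀ := by
    simpa using hp.fun_pow 2
  have h2 : HasDerivAt (fun x : ℂ => x ^ 3 + a * x + b) (3 * q₀ ^ 2 + a) q₀ := by
    simpa using ((hid.fun_pow 3).fun_add (hid.const_mul a)).add_const b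
  have h3 : 2 * p q₀ * deriv p q₀ = 3 * q₀ ^ 2 + a :=
    h1.unique (h2.congr_of_eventuallyEq hsq)
  have h4 : HasDerivAt (fun x : ℂ => α * x ^ 2 + β * x + γ) (α * (2 * q₀) + β) q₀ := by
    simpa using (((hid.fun_pow 2).const_mul α).fun_add (hid.const_mul β)).add_const γ
  rw [(h4.fun_div hp hp0).deriv]
  field_simp
  linear_combination (3 * α * q₀ + 3 * β) * h0 - (α * q₀ ^ 2 + β * q₀ + γ) * h3
end

section
/- Let a, b ∈ ℂ with Δ := 4a³ + 27b² ≠ 0. Let q, p, r : ℝ → ℂ be differentiable with p(t) ≠ 0 and p(t)² = q(t)³ + a·q(t) + b for all t, satisfying q' = −2p, p' = −(3q² + a), r' = −q. Define g(t) = −(2ap² + 3p(3b−2aq)r + (6aq²−9bq+4a²)r² − 2apr³)/(4Δp), evaluated along the flow. Then: (i) g' = (1/Δ)·(a²/2 + 9bq/4 − (9bq² + 2a²q + 6ab)r/(2p) + 9br²/4) − r²/(4p²); (ii) g'' = −(1/Δ)·((−2a²q² + 3abq + 9b²)/(2p) + a²r) + qr/p² − (3q²+a)r²/(2p³); (iii)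 g''' = −3ab/(2Δ) − 3q²/(2p²) − 2r/p + 3q(3q²+a)r/p³ + 6qr²/p² − 3(3q²+a)²r²/(2p⁴). (These are the first three derivatives of the Joyce function in the direction ∂/∂θ_a, whose pullback under the abelian holonomy map is the vector field −2p·∂/∂q − q·∂/∂r.) -/
/-- The Joyce function pulled back to the parameter space, evaluated along a path
`t ↦ (q(t), p(t), r(t))` (with `a`, `b` fixed). -/
noncomputable def JoyceAlong (a b : ℂ) (q p r : ℝ → ℂ) : ℝ → ℂ := fun t =>
  -(2 * a * p t ^ 2 + 3 * p t * (3 * b - 2 * a * q t) * r t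
      + (6 * a * q t ^ 2 - 9 * b * q t + 4 * a ^ 2) * r t ^ 2
      - 2 * a * p t * r t ^ 3) / (4 * (4 * a ^ 3 + 27 * b ^ 2) * p t)

/-- the first three derivatives of the Joyce function in the direction
`∂/∂θ_a` (whose pullback is the vector field `-2p·∂/∂q - q·∂/∂r`, realized here by
the flow `q' = -2p, p' = -(3q²+a), r' = -q` along the curve `p² = q³+aq+b`). -/
theorem joyce_function_theta_a_derivatives (a b : ℂ)
    (hΔ : 4 * a ^ 3 + 27 * b ^ 2 ≠ 0)
    (q p r : ℝ → ℂ)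
    (hq : Differentiable ℝ q) (hp : Differentiable ℝ p) (hr : Differentiable ℝ r)
    (hpne : ∀ t, p t ≠ 0)
    (hell : ∀ t, p t ^ 2 = q t ^ 3 + a * q t + b)
    (hq' : ∀ t, deriv q t = -2 * p t)
    (hp' : ∀ t, deriv p t = -(3 * q t ^ 2 + a))
    (hr' : ∀ t, deriv r t = -q t) :
    (∀ t, deriv (JoyceAlong a b q p r) t
        = (1 / (4 * a ^ 3 + 27 * b ^ 2)) *
            (a ^ 2 / 2 + 9 * b * q t / 4
              - (9 * b * q t ^ 2 + 2 * a ^ 2 * q t + 6 * a * b) * r t / (2 * p t)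
              + 9 * b * r t ^ 2 / 4)
          - r t ^ 2 / (4 * p t ^ 2)) ∧
    (∀ t, deriv (deriv (JoyceAlong a b q p r)) t
        = -(1 / (4 * a ^ 3 + 27 * b ^ 2)) *
            ((-2 * a ^ 2 * q t ^ 2 + 3 * a * b * q t + 9 * b ^ 2) / (2 * p t)
              + a ^ 2 * r t)
          + q t * r t / p t ^ 2
          - (3 * q t ^ 2 + a) * r t ^ 2 / (2 * p t ^ 3)) ∧
    (∀ t, deriv (deriv (deriv (JoyceAlong a b q p r))) t
        = -(3 * a * b) / (2 * (4 * a ^ 3 + 27 * b ^ 2))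
          - 3 * q t ^ 2 / (2 * p t ^ 2)
          - 2 * r t / p t
          + 3 * q t * (3 * q t ^ 2 + a) * r t / p t ^ 3
          + 6 * q t * r t ^ 2 / p t ^ 2
          - 3 * (3 * q t ^ 2 + a) ^ 2 * r t ^ 2 / (2 * p t ^ 4)) := by
  have Hq : ∀ t, HasDerivAt q (-2 * p t) t := fun t => hq' t ▸ (hq t).hasDerivAt
  have Hp : ∀ t, HasDerivAt p (-(3 * q t ^ 2 + a)) t := fun t => hp' t ▸ (hp t).hasDerivAt
  have Hr : ∀ t, HasDerivAt r (-q t) t := fun t => hr' t ▸ (hr t).hasDerivAt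
  have hb : ∀ t, b = p t ^ 2 - q t ^ 3 - a * q t := fun t => by rw [hell t]; ring
  have h1 : ∀ t, deriv (JoyceAlong a b q p r) t
        = (1 / (4 * a ^ 3 + 27 * b ^ 2)) *
            (a ^ 2 / 2 + 9 * b * q t / 4
              - (9 * b * q t ^ 2 + 2 * a ^ 2 * q t + 6 * a * b) * r t / (2 * p t)
              + 9 * b * r t ^ 2 / 4)
          - r t ^ 2 / (4 * p t ^ 2) := by
    intro t
    have hpt := hpne t
    have hbt := hb t
    have hN := (((((Hp t).fun_pow 2).const_mul (2 * a)).fun_add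
      ((((Hp t).const_mul 3).fun_mul (((Hq t).const_mul (2 * a)).const_sub (3 * b))).fun_mul
        (Hr t))).fun_add
      ((((((Hq t).fun_pow 2).const_mul (6 * a)).fun_sub ((Hq t).const_mul (9 * b))).add_const
        (4 * a ^ 2)).fun_mul ((Hr t).fun_pow 2))).fun_sub
      (((Hp t).const_mul (2 * a)).fun_mul ((Hr t).fun_pow 3))
    have hG : HasDerivAt (JoyceAlong a b q p r) _ t :=
      hN.fun_neg.fun_div ((Hp t).const_mul (4 * (4 * a ^ 3 + 27 * b ^ 2)))
        (mul_ne_zero (mul_ne_zero (by norm_num : (4:ℂ) ≠ 0) hΔ) hpt)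
    rw [hG.deriv]
    clear hG hN
    generalize hD : 4 * a ^ 3 + 27 * b ^ 2 = D at *
    generalize q t = Q at *
    generalize p t = P at *
    generalize r t = R at *
    field_simp
    rw [← hD, hbt]
    push_cast
    ring
  have h2 : ∀ t, deriv (deriv (JoyceAlong a b q p r)) t
        = -(1 / (4 * a ^ 3 + 27 * b ^ 2)) *
            ((-2 * a ^ 2 * q t ^ 2 + 3 * a * b * q t + 9 * b ^ 2) / (2 * p t)
              + a ^ 2 * r t)
          + q t * r t / p t ^ 2
          - (3 * q t ^ 2 + a) * r t ^ 2 / (2 * p t ^ 3) := by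
    intro t
    have hpt := hpne t
    have hbt := hb t
    rw [funext h1]
    have hG := ((((((Hq t).const_mul (9 * b)).div_const 4).const_add (a ^ 2 / 2)).fun_sub
      (((((((Hq t).fun_pow 2).const_mul (9 * b)).fun_add ((Hq t).const_mul (2 * a ^ 2))).add_const
        (6 * a * b)).fun_mul (Hr t)).fun_div ((Hp t).const_mul 2)
          (mul_ne_zero two_ne_zero hpt))).fun_add
      ((((Hr t).fun_pow 2).const_mul (9 * b)).div_const 4)).const_mul
        (1 / (4 * a ^ 3 + 27 * b ^ 2)) |>.fun_sub
      (((Hr t).fun_pow 2).fun_div (((Hp t).fun_pow 2).const_mul 4)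
        (mul_ne_zero (by norm_num : (4:ℂ) ≠ 0) (pow_ne_zero 2 hpt)))
    rw [hG.deriv]
    clear hG
    generalize hD : 4 * a ^ 3 + 27 * b ^ 2 = D at *
    generalize q t = Q at *
    generalize p t = P at *
    generalize r t = R at *
    field_simp
    rw [← hD, hbt]
    push_cast
    ring
  refine ⟨h1, h2, ?_⟩
  intro t
  have hpt := hpne t
  have hbt := hb t
  rw [funext h2]
  have hG := (((((((((Hq t).fun_pow 2).const_mul (-2 * a ^ 2)).fun_add
      ((Hq t).const_mul (3 * a * b))).add_const (9 * b ^ 2)).fun_div ((Hp t).const_mul 2)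
          (mul_ne_zero two_ne_zero hpt)).fun_add ((Hr t).const_mul (a ^ 2))).const_mul
        (-(1 / (4 * a ^ 3 + 27 * b ^ 2)))).fun_add
      (((Hq t).fun_mul (Hr t)).fun_div ((Hp t).fun_pow 2) (pow_ne_zero 2 hpt))).fun_sub
      ((((((Hq t).fun_pow 2).const_mul 3).add_const a).fun_mul ((Hr t).fun_pow 2)).fun_div
        (((Hp t).fun_pow 3).const_mul 2) (mul_ne_zero two_ne_zero (pow_ne_zero 3 hpt)))
  rw [hG.deriv]
  clear hG
  generalize hD : 4 * a ^ 3 + 27 * b ^ 2 = D at *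
  generalize q t = Q at *
  generalize p t = P at *
  generalize r t = R at *
  field_simp
  rw [← hD, hbt]
  push_cast
  ring
end

section
/- Let x ∈ ℂ. The cyclically ordered 5-tuple of points of ℙ¹ represented by the homogeneous vectors P₁ = [0:1], P₂ = [1:1], P₃ = [1:0], P₄ = [x:1], P₅ = [x+1:1] is fixed up to the projective action by the cyclic rotation, i.e. there exists an invertible 2×2 complex matrix A whose induced map on the projective line ℙ(ℂ²) satisfies A·P₁ = P₂, A·P₂ = P₃, A·P₃ = P₄, A·P₄ = P₅, A·P₅ = P₁, if and only if x² + x − 1 = 0. -/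
/-- the 5-tuple of points of `ℙ¹` with homogeneous coordinates
`[0:1], [1:1], [1:0], [x:1], [x+1:1]` is cyclically rotated by (the projectivization of)
some invertible `2×2` complex matrix `A` if and only if `x² + x - 1 = 0`.
Equality of points in `ℙ(ℂ²)` is expressed by proportionality of nonzero vectors. -/
theorem golden_ratio_fixed_point (x : ℂ) :
    (∃ A : Matrix (Fin 2) (Fin 2) ℂ, IsUnit A.det ∧
      (∃ c : ℂ, c ≠ 0 ∧ A.mulVec ![0, 1] = c • ![1, 1]) ∧
      (∃ c : ℂ, c ≠ 0 ∧ A.mulVec ![1, 1] = c • ![1, 0]) ∧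
      (∃ c : ℂ, c ≠ 0 ∧ A.mulVec ![1, 0] = c • ![x, 1]) ∧
      (∃ c : ℂ, c ≠ 0 ∧ A.mulVec ![x, 1] = c • ![x + 1, 1]) ∧
      (∃ c : ℂ, c ≠ 0 ∧ A.mulVec ![x + 1, 1] = c • ![0, 1])) ↔
    x ^ 2 + x - 1 = 0 := by
  constructor
  · rintro ⟨A, -, ⟨c1, h1, e1⟩, ⟨c2, h2, e2⟩, ⟨c3, h3, e3⟩, -, ⟨c5, h5, e5⟩⟩
    have a1 := congrFun e1 0
    have b1 := congrFun e1 1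
    have b2 := congrFun e2 1
    have a3 := congrFun e3 0
    have b3 := congrFun e3 1
    have a5 := congrFun e5 0
    simp [Matrix.mulVec, dotProduct, Fin.sum_univ_two] at a1 b1 b2 a3 b3 a5
    rw [b3, b1] at b2
    rw [a3, a1] at a5
    have : c3 * (x ^ 2 + x - 1) = 0 := by linear_combination a5 - b2
    exact (mul_eq_zero.mp this).resolve_left h3
  · intro h
    have hx0 : x ≠ 0 := by
      rintro rfl
      norm_num at h
    have hx1 : x - 1 ≠ 0 := by
      intro h1
      have : x = 1 := by linear_combination h1
      subst this
      norm_num at h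
    refine ⟨!![x, -1; 1, -1], ?_, ⟨-1, by norm_num, ?_⟩, ⟨x - 1, hx1, ?_⟩,
      ⟨1, one_ne_zero, ?_⟩, ⟨x - 1, hx1, ?_⟩, ⟨x, hx0, ?_⟩⟩
    · rw [Matrix.det_fin_two_of, isUnit_iff_ne_zero]
      intro h1
      exact hx1 (by linear_combination -h1)
    all_goals
      ext i
      fin_cases i <;> simp [Matrix.mulVec, dotProduct, Fin.sum_univ_two]
    all_goals first | ring1 | linear_combination h
end

section
/- Let R be a commutative ℂ-algebra equipped with a derivation ∂, and let Q₀, Q₁, Q₂ ∈ R with Q₀ invertible admitting an invertible square root S ∈ R (S² = Q₀). Define α₀ = S, α₁ = −∂Q₀/(4Q₀) + Q₁/(2S), α₂ = (Q₂ − ∂α₁ − α₁²)/(2S), and recursively α_k = −(∂α_{k−1} + Σ_{j=1}^{k−1} α_j α_{k−j})/(2S) for k ≥ 3. For m ≥ 0 set Φ_m = Σ_{k=0}^{m+1} ħ^{k−1} α_k in the Laurent polynomial ring R[ħ, ħ⁻¹] (extending ∂ with ∂ħ = 0). Then ħ⁻²Q₀ + ħ⁻¹Q₁ + Q₂ − ∂Φ_m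 − Φ_m² = ħ^m · (2α₀α_{m+2} − Σ_{n=m+3}^{2m+2} ħ^{n−m−2} Σ_{j+k=n, 1≤j,k≤m+1} α_j α_k); in particular the left-hand side lies in ħ^m·R[ħ], i.e. the forcing term F_m = Q − Y_m''/Y_m of the m-th WKB approximation is O(ħ^m). -/
/-- Cauchy product of a finite sum with itself, grouped by total degree. -/
lemma wkb_sq_sum {A : Type*} [CommRing A] (a : ℕ → A) (m : ℕ) :
    (∑ k ∈ Finset.range (m + 2), a k) ^ 2
      = (∑ n ∈ Finset.range (m + 2), ∑ j ∈ Finset.range (n + 1), a j * a (n - j))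
        + ∑ n ∈ Finset.Icc (m + 2) (2 * m + 2),
            ∑ j ∈ Finset.Icc (n - m - 1) (m + 1), a j * a (n - j) := by
  rw [sq, Finset.sum_mul_sum, ← Finset.sum_product',
    ← Finset.sum_filter_add_sum_filter_not _ (fun p : ℕ × ℕ => p.1 + p.2 < m + 2)]
  congr 1
  · rw [Finset.sum_sigma']
    refine Finset.sum_bij' (fun p _ => (⟨p.1 + p.2, p.1⟩ : (_ : ℕ) × ℕ))
      (fun q _ => (q.2, q.1 - q.2)) ?_ ?_ ?_ ?_ ?_
    · rintro ⟨x, y⟩ h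
      simp only [Finset.mem_filter, Finset.mem_product, Finset.mem_range,
        Finset.mem_sigma] at h ⊢
      omega
    · rintro ⟨x, y⟩ h
      simp only [Finset.mem_filter, Finset.mem_product, Finset.mem_range,
        Finset.mem_sigma] at h ⊢
      omega
    · rintro ⟨x, y⟩ h
      simp
    · rintro ⟨x, y⟩ h
      simp only [Finset.mem_range, Finset.mem_sigma] at h
      have : y + (x - y) = x := by omega
      simp [this]
    · rintro ⟨x, y⟩ h
      simp
  · rw [Finset.sum_sigma']
    refine Finset.sum_bij' (fun p _ => (⟨p.1 + p.2, p.1⟩ : (_ : ℕ) × ℕ))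
      (fun q _ => (q.2, q.1 - q.2)) ?_ ?_ ?_ ?_ ?_
    · rintro ⟨x, y⟩ h
      simp only [Finset.mem_filter, Finset.mem_product, Finset.mem_range,
        Finset.mem_sigma, Finset.mem_Icc] at h ⊢
      omega
    · rintro ⟨x, y⟩ h
      simp only [Finset.mem_filter, Finset.mem_product, Finset.mem_range,
        Finset.mem_sigma, Finset.mem_Icc] at h ⊢
      omega
    · rintro ⟨x, y⟩ h
      simp
    · rintro ⟨x, y⟩ h
      simp only [Finset.mem_Icc, Finset.mem_sigma] at h
      have : y + (x - y) = x := by omega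
      simp [this]
    · rintro ⟨x, y⟩ h
      simp

lemma wkb_sum_full {A : Type*} [CommRing A] (a : ℕ → A) (m : ℕ) :
    ∑ j ∈ Finset.range (m + 3), a j * a (m + 2 - j)
      = 2 * a 0 * a (m + 2) + ∑ j ∈ Finset.Icc 1 (m + 1), a j * a (m + 2 - j) := by
  rw [Finset.sum_range_succ, Finset.range_eq_Ico,
    Finset.sum_eq_sum_Ico_succ_bot (by omega : 0 < m + 2)]
  have : Finset.Ico (0 + 1) (m + 2) = Finset.Icc 1 (m + 1) := by
    ext x; simp only [Finset.mem_Ico, Finset.mem_Icc]; omega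
  rw [this]
  simp only [Nat.sub_zero, Nat.sub_self]
  ring

/-- Products of monomials of fixed total degree. -/
lemma wkb_term {R : Type*} [CommRing R] (α : ℕ → R) (n : ℕ) (s : Finset ℕ)
    (hs : ∀ j ∈ s, j ≤ n) :
    ∑ j ∈ s, (LaurentPolynomial.C (α j) * LaurentPolynomial.T ((j : ℤ) - 1)) *
        (LaurentPolynomial.C (α (n - j)) * LaurentPolynomial.T (((n - j : ℕ) : ℤ) - 1))
      = LaurentPolynomial.C (∑ j ∈ s, α j * α (n - j)) *
          LaurentPolynomial.T ((n : ℤ) - 2) := by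
  rw [map_sum, Finset.sum_mul]
  refine Finset.sum_congr rfl fun j hj => ?_
  have h := hs j hj
  have e : (n : ℤ) - 2 = ((j : ℤ) - 1) + (((n - j : ℕ) : ℤ) - 1) := by
    push_cast [h]; ring
  rw [e, LaurentPolynomial.T_add, map_mul]
  ring

/-- the forcing term of the `m`-th WKB approximation.
With `Φ_m = Σ_{k=0}^{m+1} ħ^{k-1} α_k` (an element of the Laurent polynomial ring
`R[ħ,ħ⁻¹]`, the derivation `∂` being extended by `∂ħ = 0`, so that
`∂Φ_m = Σ_{k=0}^{m+1} ħ^{k-1} ∂α_k`), one has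
`ħ⁻²Q₀ + ħ⁻¹Q₁ + Q₂ - ∂Φ_m - Φ_m²
  = ħ^m·(2α₀α_{m+2} - Σ_{n=m+3}^{2m+2} ħ^{n-m-2} Σ_{j+k=n, 1≤j,k≤m+1} α_j α_k)`;
in particular the forcing term `F_m = Q - Y_m''/Y_m` is `O(ħ^m)`. -/
theorem wkb_forcing_term (R : Type*) [CommRing R] [Algebra ℂ R]
    (D : Derivation ℂ R R) (Q₀ Q₁ Q₂ S : R)
    (hQ₀ : IsUnit Q₀) (hS : S * S = Q₀) (hSu : IsUnit S)
    (α : ℕ → R)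
    (hα0 : α 0 = S)
    (hα1 : 4 * Q₀ * α 1 = -(D Q₀) + 2 * S * Q₁)
    (hα2 : 2 * S * α 2 = Q₂ - D (α 1) - α 1 ^ 2)
    (hαk : ∀ k : ℕ, 3 ≤ k →
      2 * S * α k = -(D (α (k - 1)) + ∑ j ∈ Finset.Icc 1 (k - 1), α j * α (k - j)))
    (m : ℕ) :
    LaurentPolynomial.C Q₀ * LaurentPolynomial.T (-2)
        + LaurentPolynomial.C Q₁ * LaurentPolynomial.T (-1)
        + LaurentPolynomial.C Q₂
        - (∑ k ∈ Finset.range (m + 2),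
            LaurentPolynomial.C (D (α k)) * LaurentPolynomial.T ((k : ℤ) - 1))
        - (∑ k ∈ Finset.range (m + 2),
            LaurentPolynomial.C (α k) * LaurentPolynomial.T ((k : ℤ) - 1)) ^ 2
      = LaurentPolynomial.T (m : ℤ) *
          (LaurentPolynomial.C (2 * α 0 * α (m + 2))
            - ∑ n ∈ Finset.Icc (m + 3) (2 * m + 2),
                LaurentPolynomial.T ((n : ℤ) - (m : ℤ) - 2) *
                  LaurentPolynomial.C
                    (∑ j ∈ Finset.Icc (n - m - 1) (m + 1), α j * α (n - j))) := by
  have h2 : IsUnit (2 : R) := by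
    have h : IsUnit (algebraMap ℂ R 2) := (IsUnit.mk0 (2 : ℂ) two_ne_zero).map _
    rwa [map_ofNat] at h
  have h1 : D S + 2 * S * α 1 = Q₁ := by
    have hD : D Q₀ = S * D S + S * D S := by
      rw [← hS, Derivation.leibniz]; simp
    apply (h2.mul hSu).mul_left_cancel
    rw [hD, ← hS] at hα1
    linear_combination hα1
  -- the part of total degree at most `m + 1`
  have low : LaurentPolynomial.C Q₀ * LaurentPolynomial.T (-2)
        + LaurentPolynomial.C Q₁ * LaurentPolynomial.T (-1)
        + LaurentPolynomial.C Q₂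
        - (∑ k ∈ Finset.range (m + 2),
            LaurentPolynomial.C (D (α k)) * LaurentPolynomial.T ((k : ℤ) - 1))
        - (∑ n ∈ Finset.range (m + 2),
            LaurentPolynomial.C (∑ j ∈ Finset.range (n + 1), α j * α (n - j)) *
              LaurentPolynomial.T ((n : ℤ) - 2))
      = LaurentPolynomial.C (2 * α 0 * α (m + 2)
          + ∑ j ∈ Finset.Icc 1 (m + 1), α j * α (m + 2 - j)) *
          LaurentPolynomial.T (m : ℤ) := by
    induction m with
    | zero =>
      have e2 : 2 * α 0 * α 2 + α 1 * α 1 = Q₂ - D (α 1) := by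
        rw [hα0]; linear_combination hα2
      rw [← hα0] at hS h1
      simp [Finset.sum_range_succ, e2]
      rw [← hS, ← h1]
      simp only [map_mul, map_add, map_ofNat]
      ring
    | succ m ih =>
      rw [Finset.sum_range_succ _ (m + 2), Finset.sum_range_succ _ (m + 2),
        wkb_sum_full]
      have e := hαk (m + 3) (by omega)
      have e' : 2 * α 0 * α (m + 1 + 2)
          + ∑ j ∈ Finset.Icc 1 (m + 1 + 1), α j * α (m + 1 + 2 - j) = - D (α (m + 2)) := by
        rw [hα0]
        simp only [show m + 3 - 1 = m + 2 from rfl] at e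
        simp only [show m + 1 + 2 = m + 3 from rfl, show m + 1 + 1 = m + 2 from rfl]
        linear_combination e
      rw [e']
      have t1 : ((m + 2 : ℕ) : ℤ) - 1 = ((m + 1 : ℕ) : ℤ) := by push_cast; ring
      have t2 : ((m + 2 : ℕ) : ℤ) - 2 = (m : ℤ) := by push_cast; ring
      rw [t1, t2, map_neg]
      linear_combination ih
  rw [wkb_sq_sum]
  have L : ∀ n ∈ Finset.range (m + 2), _ = _ := fun n _ =>
    wkb_term α n (Finset.range (n + 1)) (fun j hj => by
      rw [Finset.mem_range] at hj; omega)
  have H : ∀ n ∈ Finset.Icc (m + 2) (2 * m + 2), _ = _ := fun n hn =>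
    wkb_term α n (Finset.Icc (n - m - 1) (m + 1)) (fun j hj => by
      rw [Finset.mem_Icc] at hj hn; omega)
  rw [Finset.sum_congr rfl L, Finset.sum_congr rfl H]
  have hI : Finset.Icc (m + 2) (2 * m + 2)
      = insert (m + 2) (Finset.Icc (m + 3) (2 * m + 2)) := by
    ext x; simp only [Finset.mem_insert, Finset.mem_Icc]; omega
  rw [hI, Finset.sum_insert (by simp)]
  have t0 : m + 2 - m - 1 = 1 := by omega
  have t2 : ((m + 2 : ℕ) : ℤ) - 2 = (m : ℤ) := by push_cast; ring
  rw [t0, t2, mul_sub, Finset.mul_sum]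
  have K : ∑ n ∈ Finset.Icc (m + 3) (2 * m + 2),
      LaurentPolynomial.T (m : ℤ) * (LaurentPolynomial.T ((n : ℤ) - (m : ℤ) - 2) *
        LaurentPolynomial.C (∑ j ∈ Finset.Icc (n - m - 1) (m + 1), α j * α (n - j)))
      = ∑ n ∈ Finset.Icc (m + 3) (2 * m + 2),
        LaurentPolynomial.C (∑ j ∈ Finset.Icc (n - m - 1) (m + 1), α j * α (n - j)) *
          LaurentPolynomial.T ((n : ℤ) - 2) := by
    refine Finset.sum_congr rfl fun n _ => ?_
    rw [← mul_assoc, ← LaurentPolynomial.T_add, mul_comm]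
    congr 2
    ring
  rw [K]
  rw [map_add] at low
  linear_combination low
end
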